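/- arXiv:2212.06918 — 5 statements merged into one kernel-verified Lean document; each statement's English description precedes it below -/
import Mathlib

section
/- Let U ⊆ ℝ³ be open and let η : U → ℝ³ be twice continuously differentiable. Set a(x) = adj(Dη(x)), with entries a^k_i(x) = adj(Dη(x))_{ki}. Then the Piola identity holds: for every i ∈ {1,2,3} and every x ∈ U, Σ_{k=1}^{3} ∂_k a^k_i(x) = 0; that is, for each fixed i the vector field x ↦ (a^1_i(x), a^2_i(x), a^3_i(x)) is divergence-free on U. -/
/-- The Jacobian matrix `Dη(x)` of a map `η : ℝ³ → ℝ³`, with entries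
`(Dη)_{ij} = ∂_j η^i(x)`. -/
noncomputable def jacMat (η : (Fin 3 → ℝ) → (Fin 3 → ℝ)) (x : Fin 3 → ℝ) :
    Matrix (Fin 3) (Fin 3) ℝ :=
  Matrix.of fun i j => fderiv ℝ η x (Pi.single j (1 : ℝ)) i

/-- The entries of the Jacobian matrix of a map of class `C²` are differentiable, and their
derivatives are given by the second derivative of the map. -/
theorem hasFDerivAt_jacMat_apply {η : (Fin 3 → ℝ) → (Fin 3 → ℝ)} {x : Fin 3 → ℝ}
    (hη : ContDiffAt ℝ 2 η x) (i j : Fin 3) :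
    HasFDerivAt (fun y => jacMat η y i j)
      ((ContinuousLinearMap.proj (R := ℝ) (φ := fun _ : Fin 3 => ℝ) i).comp
        ((fderiv ℝ (fderiv ℝ η) x).flip (Pi.single j (1 : ℝ)))) x := by
  have h : DifferentiableAt ℝ (fderiv ℝ η) x :=
    (hη.fderiv_right (m := 1) (by norm_num)).differentiableAt (by norm_num)
  have h' : HasFDerivAt (fun y => fderiv ℝ η y (Pi.single j (1 : ℝ)))
      ((fderiv ℝ (fderiv ℝ η) x).flip (Pi.single j (1 : ℝ))) x := by
    simpa using h.hasFDerivAt.clm_apply (hasFDerivAt_const (Pi.single j (1 : ℝ)) x)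
  exact hasFDerivAt_pi'.1 h' i

/-- Equality of mixed partial derivatives, in terms of the entries of the Jacobian matrix. -/
theorem fderiv_jacMat_apply_comm {η : (Fin 3 → ℝ) → (Fin 3 → ℝ)} {x : Fin 3 → ℝ}
    (hη : ContDiffAt ℝ 2 η x) (i j k : Fin 3) :
    fderiv ℝ (fun y => jacMat η y i j) x (Pi.single k (1 : ℝ)) =
      fderiv ℝ (fun y => jacMat η y i k) x (Pi.single j (1 : ℝ)) := by
  rw [(hasFDerivAt_jacMat_apply hη i j).fderiv, (hasFDerivAt_jacMat_apply hη i k).fderiv]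
  exact congrFun (hη.isSymmSndFDerivAt (by simp) _ _) i

/-- **Piola identity.** If `U ⊆ ℝ³` is open and `η : U → ℝ³` is twice continuously
differentiable, then with `a(x) = adj(Dη(x))` (entries `a^k_i = adj(Dη)_{k i}`) we have
`∑_{k} ∂_k a^k_i (x) = 0` for every `i` and every `x ∈ U`; i.e. each column field
`x ↦ (a^1_i, a^2_i, a^3_i)(x)` is divergence-free on `U`. -/
theorem piola_identity (U : Set (Fin 3 → ℝ)) (hU : IsOpen U)
    (η : (Fin 3 → ℝ) → (Fin 3 → ℝ)) (hη : ContDiffOn ℝ 2 η U) :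
    ∀ i : Fin 3, ∀ x ∈ U,
      ∑ k : Fin 3,
        fderiv ℝ (fun y => (jacMat η y).adjugate k i) x (Pi.single k (1 : ℝ)) = 0 := by
  intro i x hx
  have hηx : ContDiffAt ℝ 2 η x := hη.contDiffAt (hU.mem_nhds hx)
  have hd (i j : Fin 3) : DifferentiableAt ℝ (fun y => jacMat η y i j) x :=
    (hasFDerivAt_jacMat_apply hηx i j).differentiableAt
  have hm (i j k l : Fin 3) :
      DifferentiableAt ℝ (fun y => jacMat η y i j * jacMat η y k l) x := (hd i j).mul (hd k l)
  have hn (i j k l : Fin 3) :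
      DifferentiableAt ℝ (fun y => -(jacMat η y i j * jacMat η y k l)) x := (hm i j k l).neg
  have hc (i : Fin 3) := fderiv_jacMat_apply_comm hηx i
  fin_cases i <;>
  · simp [Fin.sum_univ_three, Matrix.adjugate_fin_three, fderiv_fun_sub, fderiv_fun_add,
      fderiv_fun_neg, fderiv_fun_mul, hd, hm, hn]
    simp only [hc _ 1 0, hc _ 2 0, hc _ 2 1]
    ring
end

section
/- Let I ⊆ ℝ be an open interval, U ⊆ ℝ³ open, and η : I × U → ℝ³ three times continuously differentiable with D_xη(t,x) invertible for all (t,x). Set v = ∂_t η and A = (D_xη)^{-1}. If curl_η(∂_t v)(t,x) = 0, i.e. ε_{kji} A^s_j ∂_s(∂_t v^i)(t,x) = 0 for each k, then ∂_t ( [curl_η v]^k )(t,x) = − ε_{kji} A^m_j(t,x) A^s_r(t,x) ∂_m v^r(t,x) ∂_s v^i(t,x) for each k ∈ {1,2,3}. -/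
/-- The Levi-Civita symbol `ε_{ijk}` on `{1,2,3}` (realized as `Fin 3`), valued in `ℝ`. -/
noncomputable def levicivita (i j k : Fin 3) : ℝ :=
  (((j : ℕ) : ℝ) - ((i : ℕ) : ℝ)) * (((k : ℕ) : ℝ) - ((i : ℕ) : ℝ)) *
    (((k : ℕ) : ℝ) - ((j : ℕ) : ℝ)) / 2

/-- The spatial Jacobian matrix `D_xη(t,x)` of a time-dependent map, with entries
`(D_xη)_{ij} = ∂_j η^i`. -/
noncomputable def jacMatX (η : ℝ × (Fin 3 → ℝ) → (Fin 3 → ℝ)) (p : ℝ × (Fin 3 → ℝ)) :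
    Matrix (Fin 3) (Fin 3) ℝ :=
  Matrix.of fun i j => fderiv ℝ η p ((0 : ℝ), Pi.single j (1 : ℝ)) i

/-- The Lagrangian velocity `v = ∂_t η`. -/
noncomputable def vel (η : ℝ × (Fin 3 → ℝ) → (Fin 3 → ℝ)) (p : ℝ × (Fin 3 → ℝ)) :
    Fin 3 → ℝ :=
  fderiv ℝ η p ((1 : ℝ), (0 : Fin 3 → ℝ))

/-- The spatial partial derivative `∂_s v^i` of the Lagrangian velocity. -/
noncomputable def dVel (η : ℝ × (Fin 3 → ℝ) → (Fin 3 → ℝ)) (p : ℝ × (Fin 3 → ℝ))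
    (s i : Fin 3) : ℝ :=
  fderiv ℝ (fun q => vel η q i) p ((0 : ℝ), Pi.single s (1 : ℝ))

/-- The time derivative `∂_t v^i` of the Lagrangian velocity. -/
noncomputable def dtVel (η : ℝ × (Fin 3 → ℝ) → (Fin 3 → ℝ)) (p : ℝ × (Fin 3 → ℝ))
    (i : Fin 3) : ℝ :=
  fderiv ℝ (fun q => vel η q i) p ((1 : ℝ), (0 : Fin 3 → ℝ))

/-- The entries of the pointwise inverse of a matrix-valued map with differentiable entries are
differentiable wherever the determinant does not vanish. -/
theorem Matrix.differentiableAt_inv_apply {E n : Type*} [NormedAddCommGroup E] [NormedSpace ℝ E]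
    [Fintype n] [DecidableEq n] {f : E → Matrix n n ℝ} {p : E}
    (hf : ∀ i j, DifferentiableAt ℝ (fun q => f q i j) p) (hp : (f p).det ≠ 0) (i j : n) :
    DifferentiableAt ℝ (fun q => (f q)⁻¹ i j) p := by
  have hdet : ∀ g : E → Matrix n n ℝ, (∀ i j, DifferentiableAt ℝ (fun q => g q i j) p) →
      DifferentiableAt ℝ (fun q => (g q).det) p := by
    intro g hg
    simp only [Matrix.det_apply']
    fun_prop
  simp only [Matrix.inv_def, Ring.inverse_eq_inv', Matrix.smul_apply, smul_eq_mul,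
    Matrix.adjugate_apply]
  refine ((hdet f hf).inv hp).mul (hdet _ fun k l => ?_)
  by_cases h : k = j
  · subst h
    simp
  · simpa [Matrix.updateRow_apply, h] using hf k l

/-- Directional derivative of the entries of the inverse of a matrix-valued map:
`∂(M⁻¹) = -M⁻¹ (∂M) M⁻¹`. -/
theorem Matrix.fderiv_inv_apply {E n : Type*} [NormedAddCommGroup E] [NormedSpace ℝ E]
    [Fintype n] [DecidableEq n] {f : E → Matrix n n ℝ} {p : E}
    (hf : ∀ i j, DifferentiableAt ℝ (fun q => f q i j) p) (hp : ∀ᶠ q in nhds p, (f q).det ≠ 0)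
    (w : E) (i j : n) :
    fderiv ℝ (fun q => (f q)⁻¹ i j) p w =
      -((f p)⁻¹ * Matrix.of (fun k l => fderiv ℝ (fun q => f q k l) p w) * (f p)⁻¹) i j := by
  have hp0 : (f p).det ≠ 0 := hp.self_of_nhds
  have hinv := Matrix.differentiableAt_inv_apply hf hp0
  set dF : Matrix n n ℝ := Matrix.of (fun k l => fderiv ℝ (fun q => f q k l) p w) with hdF
  set dA : Matrix n n ℝ := Matrix.of (fun k l => fderiv ℝ (fun q => (f q)⁻¹ k l) p w) with hdA
  have key : f p * dA + dF * (f p)⁻¹ = 0 := by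
    ext k l
    have h1 : (fun q => ∑ m, f q k m * (f q)⁻¹ m l) =ᶠ[nhds p]
        fun _ => (1 : Matrix n n ℝ) k l := by
      filter_upwards [hp] with q hq
      rw [← Matrix.mul_apply, Matrix.mul_nonsing_inv _ (isUnit_iff_ne_zero.mpr hq)]
    have h2 := congrArg (fun L : E →L[ℝ] ℝ => L w) h1.fderiv_eq
    rw [fderiv_fun_sum fun m _ => (hf k m).fun_mul (hinv m l)] at h2
    simp only [fderiv_fun_mul (hf k _) (hinv _ l)] at h2
    simpa [Finset.sum_add_distrib, Matrix.mul_apply, hdA, hdF, mul_comm] using h2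
  have hsol : dA = -((f p)⁻¹ * dF * (f p)⁻¹) := by
    have h3 := congrArg (fun M => (f p)⁻¹ * M) key
    simp only [mul_add, mul_zero, ← mul_assoc,
      Matrix.nonsing_inv_mul _ (isUnit_iff_ne_zero.mpr hp0), one_mul] at h3
    exact eq_neg_of_add_eq_zero_left h3
  exact congrFun (congrFun hsol i) j

/-- Directional derivatives of a `C²` scalar function commute. -/
theorem fderiv_fderiv_apply_comm {E : Type*} [NormedAddCommGroup E] [NormedSpace ℝ E]
    {g : E → ℝ} {p : E} (hg : ContDiffAt ℝ 2 g p) (u w : E) :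
    fderiv ℝ (fun q => fderiv ℝ g q u) p w = fderiv ℝ (fun q => fderiv ℝ g q w) p u := by
  have hd : DifferentiableAt ℝ (fderiv ℝ g) p :=
    (hg.fderiv_right (m := 1) (by norm_num)).differentiableAt (by norm_num)
  have hs : IsSymmSndFDerivAt ℝ g p := hg.isSymmSndFDerivAt (by simp)
  rw [fderiv_clm_apply hd (differentiableAt_const _), fderiv_clm_apply hd (differentiableAt_const _)]
  simpa using hs w u

/-- **Time derivative of the Lagrangian curl.** Let `η` be `C³` on `I × U` with
`D_xη` invertible, `v = ∂_t η` and `A = (D_xη)⁻¹`.  If `curl_η(∂_t v)(t,x) = 0`,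
i.e. `ε_{kji} A^s_j ∂_s(∂_t v^i)(t,x) = 0` for each `k`, then
`∂_t([curl_η v]^k)(t,x) = −ε_{kji} A^m_j A^s_r ∂_m v^r ∂_s v^i (t,x)` for each `k`. -/
theorem time_derivative_of_lagrangian_curl (a b : ℝ) (U : Set (Fin 3 → ℝ)) (hU : IsOpen U)
    (η : ℝ × (Fin 3 → ℝ) → (Fin 3 → ℝ))
    (hη : ContDiffOn ℝ 3 η (Set.Ioo a b ×ˢ U))
    (hinv : ∀ p ∈ Set.Ioo a b ×ˢ U, (jacMatX η p).det ≠ 0)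
    (t : ℝ) (x : Fin 3 → ℝ) (hmem : (t, x) ∈ Set.Ioo a b ×ˢ U)
    (hcurl : ∀ k : Fin 3,
      ∑ j : Fin 3, ∑ i : Fin 3, ∑ s : Fin 3,
        levicivita k j i * (jacMatX η (t, x))⁻¹ s j *
          fderiv ℝ (fun q => dtVel η q i) (t, x) ((0 : ℝ), Pi.single s (1 : ℝ)) = 0) :
    ∀ k : Fin 3,
      fderiv ℝ
          (fun p => ∑ j : Fin 3, ∑ i : Fin 3, ∑ s : Fin 3,
            levicivita k j i * (jacMatX η p)⁻¹ s j * dVel η p s i)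
          (t, x) ((1 : ℝ), (0 : Fin 3 → ℝ)) =
        -∑ j : Fin 3, ∑ i : Fin 3, ∑ m : Fin 3, ∑ s : Fin 3, ∑ r : Fin 3,
          levicivita k j i * (jacMatX η (t, x))⁻¹ m j * (jacMatX η (t, x))⁻¹ s r *
            dVel η (t, x) m r * dVel η (t, x) s i := by
  intro k
  have hO : Set.Ioo a b ×ˢ U ∈ nhds (t, x) := (isOpen_Ioo.prod hU).mem_nhds hmem
  have hev : ∀ᶠ q in nhds (t, x), (jacMatX η q).det ≠ 0 := by
    filter_upwards [hO] with q hq using hinv q hq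
  have hη3 : ContDiffAt ℝ 3 η (t, x) := hη.contDiffAt hO
  have hη1 : ∀ q ∈ Set.Ioo a b ×ˢ U, DifferentiableAt ℝ η q := fun q hq =>
    (hη.contDiffAt ((isOpen_Ioo.prod hU).mem_nhds hq)).differentiableAt (by norm_num)
  have hcomp : ∀ (w : ℝ × (Fin 3 → ℝ)) (i : Fin 3), (fun q => fderiv ℝ η q w i) =ᶠ[nhds (t, x)]
      fun q => fderiv ℝ (fun y => η y i) q w := by
    intro w i
    filter_upwards [hO] with q hq
    rw [fderiv_apply (hη1 q hq)]
    rfl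
  have hηi : ∀ i, ContDiffAt ℝ 3 (fun y => η y i) (t, x) := fun i => contDiffAt_pi.mp hη3 i
  have hdir : ∀ (w : ℝ × (Fin 3 → ℝ)) (i : Fin 3),
      ContDiffAt ℝ 2 (fun q => fderiv ℝ η q w i) (t, x) := fun w i =>
    (((hηi i).fderiv_right (m := 2) (by norm_num)).clm_apply contDiffAt_const).congr_of_eventuallyEq
      (hcomp w i)
  have hvel : ∀ i, ContDiffAt ℝ 2 (fun q => vel η q i) (t, x) := hdir (1, 0)
  have hJ : ∀ i j, DifferentiableAt ℝ (fun q => jacMatX η q i j) (t, x) := fun i j =>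
    (hdir (0, Pi.single j 1) i).differentiableAt (by norm_num)
  have hdJ : ∀ i j, fderiv ℝ (fun q => jacMatX η q i j) (t, x) (1, 0) = dVel η (t, x) j i := by
    intro i j
    have h1 := (hcomp (0, Pi.single j 1) i).fderiv_eq (𝕜 := ℝ)
    have h2 := (hcomp (1, 0) i).fderiv_eq (𝕜 := ℝ)
    simp only [jacMatX, dVel, vel, Matrix.of_apply]
    rw [h1, h2]
    exact fderiv_fderiv_apply_comm ((hηi i).of_le (by norm_num)) _ _
  have hA := Matrix.differentiableAt_inv_apply hJ hev.self_of_nhds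
  have hdA := Matrix.fderiv_inv_apply hJ hev ((1 : ℝ), (0 : Fin 3 → ℝ))
  have hV : ∀ s i, DifferentiableAt ℝ (fun q => dVel η q s i) (t, x) := fun s i =>
    (((hvel i).fderiv_right (m := 1) (by norm_num)).clm_apply contDiffAt_const).differentiableAt
      (by norm_num)
  have hdV : ∀ s i, fderiv ℝ (fun q => dVel η q s i) (t, x) (1, 0) =
      fderiv ℝ (fun q => dtVel η q i) (t, x) (0, Pi.single s 1) := fun s i =>
    fderiv_fderiv_apply_comm (hvel i) _ _
  have hterm : ∀ j i s, HasFDerivAt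
      (fun q => levicivita k j i * (jacMatX η q)⁻¹ s j * dVel η q s i) _ (t, x) := fun j i s =>
    ((hA s j).hasFDerivAt.const_mul (levicivita k j i)).fun_mul (hV s i).hasFDerivAt
  rw [(HasFDerivAt.fun_sum fun j _ => HasFDerivAt.fun_sum fun i _ =>
    HasFDerivAt.fun_sum fun s _ => hterm j i s).fderiv]
  simp only [sum_apply, add_apply,
    smul_apply, smul_eq_mul, hdV, hdA, hdJ, Finset.sum_add_distrib, hcurl k,
    zero_add, ← Finset.sum_neg_distrib]
  refine Finset.sum_congr rfl fun j _ => Finset.sum_congr rfl fun i _ => ?_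
  rw [Finset.sum_comm]
  refine Finset.sum_congr rfl fun s _ => ?_
  simp only [Matrix.mul_apply, Matrix.of_apply, Finset.sum_mul, Finset.mul_sum,
    ← Finset.sum_neg_distrib]
  refine Finset.sum_congr rfl fun m _ => Finset.sum_congr rfl fun r _ => ?_
  ring
end

section
/- Let U ⊆ ℝ³ be open, T > 0, and let η : [0,T] × U → ℝ³ be three times continuously differentiable with η(0,x) = x and with D_xη(t,x) invertible for all (t,x). Set v = ∂_t η and A = (D_xη)^{-1}, and assume curl_η(∂_t v) = 0 on [0,T] × U. Then the Cauchy invariance formula holds: for every k, every t ∈ [0,T], and every x ∈ U, [curl_η v]^k(t,x) = [curl v(0,·)]^k(x) − ∫₀ᵗ ε_{kji} A^m_j A^s_r ∂_m v^r ∂_s v^i (t',x) dt', where curl denotes the ordinary spatial curl, [curl F]^k = ε_{kji} ∂_j F^i. -/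
/-- The space-time domain `[0,T] × U`. -/
def spaceTime (T : ℝ) (U : Set (Fin 3 → ℝ)) : Set (ℝ × (Fin 3 → ℝ)) :=
  Set.Icc 0 T ×ˢ U

/-- The Lagrangian velocity `v = ∂_t η` (derivative within `S`). -/
noncomputable def velW (S : Set (ℝ × (Fin 3 → ℝ))) (η : ℝ × (Fin 3 → ℝ) → (Fin 3 → ℝ))
    (p : ℝ × (Fin 3 → ℝ)) : Fin 3 → ℝ :=
  fderivWithin ℝ η S p ((1 : ℝ), (0 : Fin 3 → ℝ))

/-- The spatial Jacobian matrix `D_xη`, with entries `(D_xη)_{ij} = ∂_j η^i`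
(derivatives within `S`). -/
noncomputable def jacW (S : Set (ℝ × (Fin 3 → ℝ))) (η : ℝ × (Fin 3 → ℝ) → (Fin 3 → ℝ))
    (p : ℝ × (Fin 3 → ℝ)) : Matrix (Fin 3) (Fin 3) ℝ :=
  Matrix.of fun i j => fderivWithin ℝ η S p ((0 : ℝ), Pi.single j (1 : ℝ)) i

/-- The inverse of the deformation tensor, `A = (D_xη)⁻¹`. -/
noncomputable def AmatW (S : Set (ℝ × (Fin 3 → ℝ))) (η : ℝ × (Fin 3 → ℝ) → (Fin 3 → ℝ))
    (p : ℝ × (Fin 3 → ℝ)) : Matrix (Fin 3) (Fin 3) ℝ :=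
  (jacW S η p)⁻¹

/-- The spatial partial derivative `∂_s v^i` of the Lagrangian velocity. -/
noncomputable def dVelW (S : Set (ℝ × (Fin 3 → ℝ))) (η : ℝ × (Fin 3 → ℝ) → (Fin 3 → ℝ))
    (p : ℝ × (Fin 3 → ℝ)) (s i : Fin 3) : ℝ :=
  fderivWithin ℝ (fun q => velW S η q i) S p ((0 : ℝ), Pi.single s (1 : ℝ))

/-- The time derivative `∂_t v^i` of the Lagrangian velocity. -/
noncomputable def dtVelW (S : Set (ℝ × (Fin 3 → ℝ))) (η : ℝ × (Fin 3 → ℝ) → (Fin 3 → ℝ))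
    (p : ℝ × (Fin 3 → ℝ)) (i : Fin 3) : ℝ :=
  fderivWithin ℝ (fun q => velW S η q i) S p ((1 : ℝ), (0 : Fin 3 → ℝ))

theorem uniqueDiffOn_spaceTime {T : ℝ} (hT : 0 < T) {U : Set (Fin 3 → ℝ)} (hU : IsOpen U) :
    UniqueDiffOn ℝ (spaceTime T U) :=
  (uniqueDiffOn_Icc hT).prod hU.uniqueDiffOn

theorem spaceTime_subset_closure_interior {T : ℝ} (hT : 0 < T) {U : Set (Fin 3 → ℝ)}
    (hU : IsOpen U) : spaceTime T U ⊆ closure (interior (spaceTime T U)) := by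
  rw [spaceTime, interior_prod_eq, closure_prod_eq, interior_Icc, closure_Ioo hT.ne,
    hU.interior_eq]
  exact Set.prod_mono subset_rfl subset_closure

section Calculus

variable {E F : Type*} [NormedAddCommGroup E] [NormedSpace ℝ E] [NormedAddCommGroup F]
  [NormedSpace ℝ F]

/-- Directional derivatives of a `C^{n+1}` function are `C^n`. -/
theorem ContDiffOn.fderivWithin_apply_const {S : Set E} {f : E → F} {m n : WithTop ℕ∞}
    (hf : ContDiffOn ℝ n f S) (hS : UniqueDiffOn ℝ S) (hmn : m + 1 ≤ n) (a : E) :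
    ContDiffOn ℝ m (fun q => fderivWithin ℝ f S q a) S :=
  (hf.fderivWithin hS hmn).clm_apply contDiffOn_const

/-- Directional derivatives of a `C²` function commute. -/
theorem ContDiffOn.fderivWithin_fderivWithin_comm {S : Set E} {f : E → F}
    (hf : ContDiffOn ℝ 2 f S) (hS : UniqueDiffOn ℝ S) (hcl : S ⊆ closure (interior S))
    {p : E} (hp : p ∈ S) (a b : E) :
    fderivWithin ℝ (fun q => fderivWithin ℝ f S q a) S p b =
      fderivWithin ℝ (fun q => fderivWithin ℝ f S q b) S p a := by
  have hd : DifferentiableWithinAt ℝ (fderivWithin ℝ f S) S p :=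
    (hf.fderivWithin hS (m := 1) (by norm_num)).differentiableOn one_ne_zero p hp
  have key : ∀ c d : E, fderivWithin ℝ (fun q => fderivWithin ℝ f S q c) S p d =
      fderivWithin ℝ (fderivWithin ℝ f S) S p d c := by
    intro c d
    rw [fderivWithin_clm_apply (hS p hp) hd (differentiableWithinAt_const c)]
    simp
  rw [key, key]
  exact (hf p hp).isSymmSndFDerivWithinAt (by simp) hS (hcl hp) hp b a

/-- The restriction of `f` to a time line has the directional derivative as its derivative. -/
theorem DifferentiableOn.hasDerivWithinAt_prod_line {s : Set ℝ} {U : Set E} {f : ℝ × E → F}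
    (hf : DifferentiableOn ℝ f (s ×ˢ U)) {t : ℝ} (ht : t ∈ s) {x : E} (hx : x ∈ U) :
    HasDerivWithinAt (fun τ => f (τ, x)) (fderivWithin ℝ f (s ×ˢ U) (t, x) (1, 0)) s t :=
  (hf (t, x) ⟨ht, hx⟩).hasFDerivWithinAt.comp_hasDerivWithinAt t
    ((hasDerivWithinAt_id t s).prodMk (hasDerivWithinAt_const t s x))
    (fun _ hτ => Set.mk_mem_prod hτ hx)

end Calculus

section MatrixCalculus

variable {n : Type*} [Fintype n] [DecidableEq n]

theorem DifferentiableWithinAt.matrix_det {M : ℝ → Matrix n n ℝ} {s : Set ℝ} {t : ℝ}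
    (hM : ∀ i j, DifferentiableWithinAt ℝ (fun τ => M τ i j) s t) :
    DifferentiableWithinAt ℝ (fun τ => (M τ).det) s t := by
  simp only [Matrix.det_apply']
  exact DifferentiableWithinAt.fun_sum fun σ _ =>
    (DifferentiableWithinAt.fun_finsetProd fun i _ => hM _ _).const_mul _

theorem DifferentiableWithinAt.matrix_inv {M : ℝ → Matrix n n ℝ} {s : Set ℝ} {t : ℝ}
    (hM : ∀ i j, DifferentiableWithinAt ℝ (fun τ => M τ i j) s t) (hdet : (M t).det ≠ 0)
    (i j : n) : DifferentiableWithinAt ℝ (fun τ => (M τ)⁻¹ i j) s t := by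
  simp only [Matrix.inv_def, Ring.inverse_eq_inv', Matrix.smul_apply, smul_eq_mul,
    Matrix.adjugate_apply]
  refine ((DifferentiableWithinAt.matrix_det hM).inv hdet).mul
    (DifferentiableWithinAt.matrix_det fun a b => ?_)
  by_cases h : a = j
  · subst h
    simpa using differentiableWithinAt_const _
  · simpa [Matrix.updateRow_ne h] using hM a b

/-- The entrywise formula `(M⁻¹)' = - M⁻¹ M' M⁻¹`. -/
theorem hasDerivWithinAt_matrix_inv {M : ℝ → Matrix n n ℝ} {M' : Matrix n n ℝ} {s : Set ℝ}
    {t : ℝ} (hs : UniqueDiffWithinAt ℝ s t) (ht : t ∈ s)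
    (hM : ∀ i j, HasDerivWithinAt (fun τ => M τ i j) (M' i j) s t)
    (hdet : ∀ τ ∈ s, (M τ).det ≠ 0) (i j : n) :
    HasDerivWithinAt (fun τ => (M τ)⁻¹ i j) ((-((M t)⁻¹ * M' * (M t)⁻¹)) i j) s t := by
  have hA := DifferentiableWithinAt.matrix_inv (fun i j => (hM i j).differentiableWithinAt)
    (hdet t ht)
  set A' : Matrix n n ℝ := Matrix.of fun i j => derivWithin (fun τ => (M τ)⁻¹ i j) s t with hA'
  have hAd : ∀ i j, HasDerivWithinAt (fun τ => (M τ)⁻¹ i j) (A' i j) s t :=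
    fun i j => (hA i j).hasDerivWithinAt
  have hzero : A' * M t + (M t)⁻¹ * M' = 0 := by
    ext a b
    have h1 : HasDerivWithinAt (fun τ => ∑ c, (M τ)⁻¹ a c * M τ c b)
        (∑ c, (A' a c * M t c b + (M t)⁻¹ a c * M' c b)) s t :=
      HasDerivWithinAt.fun_sum fun c _ => (hAd a c).mul (hM c b)
    have h2 : HasDerivWithinAt (fun τ => ∑ c, (M τ)⁻¹ a c * M τ c b) 0 s t := by
      refine (hasDerivWithinAt_const t s ((1 : Matrix n n ℝ) a b)).congr_of_mem
        (fun τ hτ => ?_) ht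
      rw [← Matrix.mul_apply, Matrix.nonsing_inv_mul _ (hdet τ hτ).isUnit]
    simpa [Matrix.mul_apply, Finset.sum_add_distrib] using hs.eq_deriv _ h1 h2
  have hA'eq : A' = -((M t)⁻¹ * M' * (M t)⁻¹) := by
    rw [← Matrix.mul_nonsing_inv_cancel_right (M t) A' (hdet t ht).isUnit,
      eq_neg_of_add_eq_zero_left hzero, Matrix.neg_mul]
  rw [← hA'eq]
  exact hAd i j

end MatrixCalculus

section Flow

variable {T : ℝ} {U : Set (Fin 3 → ℝ)} {η : ℝ × (Fin 3 → ℝ) → (Fin 3 → ℝ)}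

theorem velW_contDiffOn (hT : 0 < T) (hU : IsOpen U) (hη : ContDiffOn ℝ 3 η (spaceTime T U))
    (i : Fin 3) : ContDiffOn ℝ 2 (fun q => velW (spaceTime T U) η q i) (spaceTime T U) :=
  contDiffOn_pi.1 (hη.fderivWithin_apply_const (uniqueDiffOn_spaceTime hT hU)
    (by norm_num) _) i

/-- `∂_t (D_xη)_{ij} = ∂_j v^i`. -/
theorem jacW_hasDerivWithinAt (hT : 0 < T) (hU : IsOpen U)
    (hη : ContDiffOn ℝ 3 η (spaceTime T U)) {x : Fin 3 → ℝ} (hx : x ∈ U) {t : ℝ}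
    (ht : t ∈ Set.Icc 0 T) (i j : Fin 3) :
    HasDerivWithinAt (fun τ => jacW (spaceTime T U) η (τ, x) i j)
      (dVelW (spaceTime T U) η (t, x) j i) (Set.Icc 0 T) t := by
  have hS := uniqueDiffOn_spaceTime hT hU
  have hp : (t, x) ∈ spaceTime T U := ⟨ht, hx⟩
  have hcomp : ∀ k, DifferentiableWithinAt ℝ (fun q => velW (spaceTime T U) η q k)
      (spaceTime T U) (t, x) := fun k =>
    (velW_contDiffOn hT hU hη k).differentiableOn two_ne_zero _ hp
  have h := DifferentiableOn.hasDerivWithinAt_prod_line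
    ((hη.fderivWithin_apply_const hS (m := 2) (by norm_num)
      ((0 : ℝ), Pi.single j (1 : ℝ))).differentiableOn two_ne_zero) ht hx
  have h' := hasDerivWithinAt_pi.1 h i
  refine h'.congr_deriv ?_
  have hcomm := congrFun ((hη.of_le (by norm_num)).fderivWithin_fderivWithin_comm hS
    (spaceTime_subset_closure_interior hT hU) hp ((0 : ℝ), Pi.single j (1 : ℝ)) (1, 0)) i
  refine hcomm.trans ?_
  change fderivWithin ℝ (fun q k => velW (spaceTime T U) η q k) (spaceTime T U) (t, x)
    ((0 : ℝ), Pi.single j (1 : ℝ)) i = _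
  rw [dVelW, fderivWithin_pi hcomp (hS _ hp)]
  rfl

/-- `∂_t ∂_s v^i = ∂_s ∂_t v^i`. -/
theorem dVelW_hasDerivWithinAt (hT : 0 < T) (hU : IsOpen U)
    (hη : ContDiffOn ℝ 3 η (spaceTime T U)) {x : Fin 3 → ℝ} (hx : x ∈ U) {t : ℝ}
    (ht : t ∈ Set.Icc 0 T) (s i : Fin 3) :
    HasDerivWithinAt (fun τ => dVelW (spaceTime T U) η (τ, x) s i)
      (fderivWithin ℝ (fun q => dtVelW (spaceTime T U) η q i) (spaceTime T U) (t, x)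
        ((0 : ℝ), Pi.single s (1 : ℝ))) (Set.Icc 0 T) t := by
  have hS := uniqueDiffOn_spaceTime hT hU
  have hv := velW_contDiffOn hT hU hη i
  have h := DifferentiableOn.hasDerivWithinAt_prod_line
    ((hv.fderivWithin_apply_const hS (m := 1) (by norm_num)
      ((0 : ℝ), Pi.single s (1 : ℝ))).differentiableOn one_ne_zero) ht hx
  exact h.congr_deriv (hv.fderivWithin_fderivWithin_comm hS
    (spaceTime_subset_closure_interior hT hU) (Set.mk_mem_prod ht hx) _ _)

/-- `∂_t A^s_j = - A^s_r ∂_m v^r A^m_j`. -/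
theorem AmatW_hasDerivWithinAt (hT : 0 < T) (hU : IsOpen U)
    (hη : ContDiffOn ℝ 3 η (spaceTime T U))
    (hinv : ∀ p ∈ spaceTime T U, (jacW (spaceTime T U) η p).det ≠ 0)
    {x : Fin 3 → ℝ} (hx : x ∈ U) {t : ℝ} (ht : t ∈ Set.Icc 0 T) (s j : Fin 3) :
    HasDerivWithinAt (fun τ => AmatW (spaceTime T U) η (τ, x) s j)
      (-∑ m, ∑ r, AmatW (spaceTime T U) η (t, x) m j * AmatW (spaceTime T U) η (t, x) s r *
        dVelW (spaceTime T U) η (t, x) m r) (Set.Icc 0 T) t := by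
  have h := hasDerivWithinAt_matrix_inv (M := fun τ => jacW (spaceTime T U) η (τ, x))
    (M' := Matrix.of fun i j => dVelW (spaceTime T U) η (t, x) j i)
    (uniqueDiffOn_Icc hT t ht) ht (fun i j => jacW_hasDerivWithinAt hT hU hη hx ht i j)
    (fun τ hτ => hinv _ ⟨hτ, hx⟩) s j
  refine h.congr_deriv ?_
  rw [Matrix.neg_apply, Matrix.mul_apply]
  simp only [Matrix.mul_apply, Matrix.of_apply, Finset.sum_mul]
  refine congrArg _ (Finset.sum_congr rfl fun m _ => Finset.sum_congr rfl fun r _ => ?_)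
  simp only [AmatW]
  ring

theorem jacW_zero (hT : 0 < T) (hU : IsOpen U) (hη : ContDiffOn ℝ 3 η (spaceTime T U))
    (hid : ∀ x ∈ U, η (0, x) = x) {x : Fin 3 → ℝ} (hx : x ∈ U) :
    jacW (spaceTime T U) η (0, x) = 1 := by
  have h0 : (0 : ℝ) ∈ Set.Icc 0 T := ⟨le_rfl, hT.le⟩
  have h1 : HasFDerivWithinAt (fun y => η (0, y))
      ((fderivWithin ℝ η (spaceTime T U) (0, x)).comp (ContinuousLinearMap.inr ℝ ℝ _)) U x :=
    ((hη.differentiableOn three_ne_zero (0, x) ⟨h0, hx⟩).hasFDerivWithinAt).comp x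
      (hasFDerivAt_prodMk_right (0 : ℝ) x).hasFDerivWithinAt fun _ hy => ⟨h0, hy⟩
  have h2 : HasFDerivWithinAt (fun y => η (0, y)) (ContinuousLinearMap.id ℝ (Fin 3 → ℝ)) U x :=
    (hasFDerivWithinAt_id x U).congr hid (hid x hx)
  have h := (hU.uniqueDiffWithinAt hx).eq h1 h2
  ext i j
  have := congrFun (DFunLike.congr_fun h (Pi.single j (1 : ℝ))) i
  simpa [jacW, Matrix.one_apply, Pi.single_apply] using this

end Flow

/-- **Cauchy invariance.** Let `η` be `C³` on `[0,T] × U` with `η(0,x) = x` and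
`D_xη` invertible, set `v = ∂_t η`, `A = (D_xη)⁻¹`, and assume `curl_η(∂_t v) = 0` on
`[0,T] × U`. Then for every `k`, `t ∈ [0,T]`, `x ∈ U`,
`[curl_η v]^k(t,x) = [curl v(0,·)]^k(x) − ∫₀ᵗ ε_{kji} A^m_j A^s_r ∂_m v^r ∂_s v^i (t',x) dt'`. -/
theorem cauchy_invariance (T : ℝ) (hT : 0 < T) (U : Set (Fin 3 → ℝ)) (hU : IsOpen U)
    (η : ℝ × (Fin 3 → ℝ) → (Fin 3 → ℝ))
    (hη : ContDiffOn ℝ 3 η (spaceTime T U))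
    (hid : ∀ x ∈ U, η (0, x) = x)
    (hinv : ∀ p ∈ spaceTime T U, (jacW (spaceTime T U) η p).det ≠ 0)
    (hcurl : ∀ p ∈ spaceTime T U, ∀ k : Fin 3,
      ∑ j : Fin 3, ∑ i : Fin 3, ∑ s : Fin 3,
        levicivita k j i * AmatW (spaceTime T U) η p s j *
          fderivWithin ℝ (fun q => dtVelW (spaceTime T U) η q i) (spaceTime T U) p
            ((0 : ℝ), Pi.single s (1 : ℝ)) = 0) :
    ∀ k : Fin 3, ∀ t ∈ Set.Icc (0 : ℝ) T, ∀ x ∈ U,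
      (∑ j : Fin 3, ∑ i : Fin 3, ∑ s : Fin 3,
          levicivita k j i * AmatW (spaceTime T U) η (t, x) s j *
            dVelW (spaceTime T U) η (t, x) s i) =
        (∑ j : Fin 3, ∑ i : Fin 3,
          levicivita k j i * dVelW (spaceTime T U) η (0, x) j i) -
        ∫ t' in (0 : ℝ)..t,
          ∑ j : Fin 3, ∑ i : Fin 3, ∑ m : Fin 3, ∑ s : Fin 3, ∑ r : Fin 3,
            levicivita k j i * AmatW (spaceTime T U) η (t', x) m j *
              AmatW (spaceTime T U) η (t', x) s r *
              dVelW (spaceTime T U) η (t', x) m r * dVelW (spaceTime T U) η (t', x) s i := by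
  intro k t ht x hx
  have hsub : Set.Icc 0 t ⊆ Set.Icc 0 T := Set.Icc_subset_Icc_right ht.2
  have hAd := fun τ (hτ : τ ∈ Set.Icc 0 T) => AmatW_hasDerivWithinAt hT hU hη hinv hx hτ
  have hVd := fun τ (hτ : τ ∈ Set.Icc 0 T) => dVelW_hasDerivWithinAt hT hU hη hx hτ
  have hAc : ∀ s j, ContinuousOn (fun τ => AmatW (spaceTime T U) η (τ, x) s j) (Set.Icc 0 t) :=
    fun s j τ hτ => ((hAd τ (hsub hτ) s j).continuousWithinAt).mono hsub
  have hVc : ∀ s i, ContinuousOn (fun τ => dVelW (spaceTime T U) η (τ, x) s i) (Set.Icc 0 t) :=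
    fun s i τ hτ => ((hVd τ (hsub hτ) s i).continuousWithinAt).mono hsub
  have hderiv : ∀ τ ∈ Set.Icc 0 T, HasDerivWithinAt
      (fun τ => ∑ j : Fin 3, ∑ i : Fin 3, ∑ s : Fin 3,
        levicivita k j i * AmatW (spaceTime T U) η (τ, x) s j * dVelW (spaceTime T U) η (τ, x) s i)
      (-∑ j : Fin 3, ∑ i : Fin 3, ∑ m : Fin 3, ∑ s : Fin 3, ∑ r : Fin 3,
        levicivita k j i * AmatW (spaceTime T U) η (τ, x) m j *
          AmatW (spaceTime T U) η (τ, x) s r *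
          dVelW (spaceTime T U) η (τ, x) m r * dVelW (spaceTime T U) η (τ, x) s i)
      (Set.Icc 0 T) τ := by
    intro τ hτ
    have h := HasDerivWithinAt.fun_sum (u := Finset.univ) fun j _ =>
      HasDerivWithinAt.fun_sum (u := Finset.univ) fun i _ =>
        HasDerivWithinAt.fun_sum (u := Finset.univ) fun s _ =>
          ((hAd τ hτ s j).const_mul (levicivita k j i)).mul (hVd τ hτ s i)
    refine h.congr_deriv ?_
    simp only [Finset.sum_add_distrib]
    rw [hcurl _ ⟨hτ, hx⟩ k, add_zero]
    simp only [← Finset.sum_neg_distrib]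
    refine Finset.sum_congr rfl fun j _ => Finset.sum_congr rfl fun i _ => ?_
    rw [Finset.sum_comm]
    simp only [Finset.mul_sum, Finset.sum_mul]
    refine Finset.sum_congr rfl fun m _ => Finset.sum_congr rfl fun s _ =>
      Finset.sum_congr rfl fun r _ => ?_
    ring
  have hftc := intervalIntegral.integral_eq_sub_of_hasDerivAt_of_le ht.1
    (fun τ hτ => ((hderiv τ (hsub hτ)).continuousWithinAt).mono hsub)
    (fun τ hτ => (hderiv τ (hsub (Set.Ioo_subset_Icc_self hτ))).hasDerivAt
      (Icc_mem_nhds hτ.1 (hτ.2.trans_le ht.2)))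
    (ContinuousOn.intervalIntegrable_of_Icc ht.1 (by fun_prop))
  rw [intervalIntegral.integral_neg] at hftc
  have hinit : (∑ j : Fin 3, ∑ i : Fin 3, ∑ s : Fin 3,
      levicivita k j i * AmatW (spaceTime T U) η (0, x) s j *
        dVelW (spaceTime T U) η (0, x) s i) =
      ∑ j : Fin 3, ∑ i : Fin 3, levicivita k j i * dVelW (spaceTime T U) η (0, x) j i := by
    simp [AmatW, jacW_zero hT hU hη hid hx, Matrix.one_apply]
  rw [hinit] at hftc
  linarith
end

section
/- For every integer b ≥ 1 there exists a constant C > 0, depending only on b, such that for every b-times continuously differentiable function f : [0,1] → ℝ, Σ_{j=0}^{b−1} ∫₀¹ |f^{(j)}(x)|² dx ≤ C Σ_{k=0}^{b} ∫₀¹ (1−x)² |f^{(k)}(x)|² dx. -/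
/-- Hardy inequality with weight `(1 - x) ^ 2` for one derivative. -/
theorem integral_sq_le_weighted {g h : ℝ → ℝ}
    (hg : ContinuousOn g (Set.Icc 0 1)) (hh : ContinuousOn h (Set.Icc 0 1))
    (hd : ∀ x ∈ Set.Ioo (0 : ℝ) 1, HasDerivAt g (h x) x) :
    ∫ x in (0 : ℝ)..1, |g x| ^ 2 ≤
      8 * ((∫ x in (0 : ℝ)..1, (1 - x) ^ 2 * |g x| ^ 2) +
        ∫ x in (0 : ℝ)..1, (1 - x) ^ 2 * |h x| ^ 2) := by
  have integrable {u : ℝ → ℝ} (hu : ContinuousOn u (Set.Icc 0 1)) :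
      IntervalIntegrable u MeasureTheory.volume 0 1 :=
    hu.intervalIntegrable_of_Icc zero_le_one
  simp only [sq_abs]
  have hI₁ := integrable (u := fun x => (1 - x) ^ 2 * g x ^ 2) (by fun_prop)
  have hI₂ := integrable (u := fun x => (1 - x) ^ 2 * h x ^ 2) (by fun_prop)
  have hI₃ := integrable
    (u := fun x => (1 - 2 * x) * g x ^ 2 + x * (1 - x) * (2 * g x * h x)) (by fun_prop)
  have hzero : ∫ x in (0 : ℝ)..1,
      ((1 - 2 * x) * g x ^ 2 + x * (1 - x) * (2 * g x * h x)) = 0 := by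
    rw [intervalIntegral.integral_eq_sub_of_hasDerivAt_of_le zero_le_one
      (f := fun x => x * (1 - x) * g x ^ 2) (by fun_prop) _ hI₃]
    · simp
    · intro x hx
      have h₁ : HasDerivAt (fun x : ℝ => x * (1 - x)) (1 - 2 * x) x := by
        refine ((hasDerivAt_id x).mul ((hasDerivAt_id x).const_sub 1)).congr_deriv ?_
        simp only [id_eq]
        ring
      refine (h₁.mul ((hd x hx).pow 2)).congr_deriv ?_
      simp
  have hle : ∫ x in (0 : ℝ)..1, g x ^ 2 ≤ ∫ x in (0 : ℝ)..1,
      (8 * ((1 - x) ^ 2 * g x ^ 2 + (1 - x) ^ 2 * h x ^ 2) -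
        2 * ((1 - 2 * x) * g x ^ 2 + x * (1 - x) * (2 * g x * h x))) := by
    refine intervalIntegral.integral_mono_on zero_le_one (integrable (by fun_prop))
      (((hI₁.add hI₂).const_mul 8).sub (hI₃.const_mul 2)) fun x hx => ?_
    have hx₁ : 0 ≤ 1 - x ^ 2 := by nlinarith [hx.1, hx.2]
    nlinarith [sq_nonneg (x * g x - 4 * ((1 - x) * h x)),
      mul_nonneg hx₁ (sq_nonneg (g x)), sq_nonneg ((4 * (1 - x) - 1) * g x)]
  rw [intervalIntegral.integral_sub ((hI₁.add hI₂).const_mul 8) (hI₃.const_mul 2),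
    intervalIntegral.integral_const_mul, intervalIntegral.integral_const_mul,
    intervalIntegral.integral_add hI₁ hI₂, hzero] at hle
  linarith


/-- **One-dimensional Hardy inequality** (weight exponent `a = 2`). For every integer
`b ≥ 1` there is a constant `C > 0`, depending only on `b`, such that for every `b`-times
continuously differentiable `f : [0,1] → ℝ`,
`∑_{j=0}^{b−1} ∫₀¹ |f^{(j)}|² ≤ C ∑_{k=0}^{b} ∫₀¹ (1−x)² |f^{(k)}|²`. -/
theorem hardy_inequality_one_dim (b : ℕ) (hb : 1 ≤ b) :
    ∃ C : ℝ, 0 < C ∧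
      ∀ f : ℝ → ℝ, ContDiffOn ℝ b f (Set.Icc 0 1) →
        ∑ j ∈ Finset.range b,
            ∫ x in (0 : ℝ)..1, |iteratedDerivWithin j f (Set.Icc 0 1) x| ^ 2 ≤
          C * ∑ k ∈ Finset.range (b + 1),
            ∫ x in (0 : ℝ)..1,
              (1 - x) ^ 2 * |iteratedDerivWithin k f (Set.Icc 0 1) x| ^ 2 := by
  refine ⟨16, by norm_num, fun f hf => ?_⟩
  have hs : UniqueDiffOn ℝ (Set.Icc (0 : ℝ) 1) := uniqueDiffOn_Icc zero_lt_one
  set W : ℕ → ℝ := fun k => ∫ x in (0 : ℝ)..1,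
    (1 - x) ^ 2 * |iteratedDerivWithin k f (Set.Icc 0 1) x| ^ 2
  have hW : ∀ k, 0 ≤ W k := fun k =>
    intervalIntegral.integral_nonneg zero_le_one fun x _ => by positivity
  have hstep : ∀ j ∈ Finset.range b,
      ∫ x in (0 : ℝ)..1, |iteratedDerivWithin j f (Set.Icc 0 1) x| ^ 2 ≤
        8 * (W j + W (j + 1)) := by
    intro j hj
    have hjb : j < b := Finset.mem_range.mp hj
    refine integral_sq_le_weighted
      (hf.continuousOn_iteratedDerivWithin (by exact_mod_cast hjb.le) hs)
      (hf.continuousOn_iteratedDerivWithin (by exact_mod_cast hjb) hs) fun x hx => ?_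
    rw [iteratedDerivWithin_succ]
    exact (hf.differentiableOn_iteratedDerivWithin (by exact_mod_cast hjb) hs x
      (Set.Ioo_subset_Icc_self hx)).hasDerivWithinAt.hasDerivAt (Icc_mem_nhds hx.1 hx.2)
  refine (Finset.sum_le_sum hstep).trans ?_
  rw [← Finset.mul_sum, Finset.sum_add_distrib]
  linarith [Finset.sum_range_succ W b, Finset.sum_range_succ' W b, hW 0, hW b]
end

section
/- Let T > 0 and let η : [0,T] × ℝ³ → ℝ³ be twice continuously differentiable with η(t, x + k) = η(t,x) + k for all k ∈ ℤ² × {0}, and suppose η³(t,x) = 0 whenever x₃ = 0. Set v = ∂_t η. Then for every t ∈ [0,T], d/dt ∫_{[0,1]³} det D_xη(t,x) dx = ∫_{[0,1]²} [ (∂₁η × ∂₂η) · v ](t, (x₁,x₂,1)) dx₁ dx₂; that is, the rate of change of the Lagrangian volume equals the flux of the velocity through the top (free) boundary. -/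
open MeasureTheory

/-- The space-time slab `[0,T] × ℝ³`. -/
def timeSlab (T : ℝ) : Set (ℝ × (Fin 3 → ℝ)) :=
  Set.Icc 0 T ×ˢ Set.univ

/-- The spatial Jacobian matrix `D_xη`, with entries `(D_xη)_{ij} = ∂_j η^i`
(derivatives within the slab `[0,T] × ℝ³`). -/
noncomputable def DxW (T : ℝ) (η : ℝ × (Fin 3 → ℝ) → (Fin 3 → ℝ))
    (p : ℝ × (Fin 3 → ℝ)) : Matrix (Fin 3) (Fin 3) ℝ :=
  Matrix.of fun i j => fderivWithin ℝ η (timeSlab T) p ((0 : ℝ), Pi.single j (1 : ℝ)) i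

/-- The Lagrangian velocity `v = ∂_t η` (derivative within the slab). -/
noncomputable def vW (T : ℝ) (η : ℝ × (Fin 3 → ℝ) → (Fin 3 → ℝ))
    (p : ℝ × (Fin 3 → ℝ)) : Fin 3 → ℝ :=
  fderivWithin ℝ η (timeSlab T) p ((1 : ℝ), (0 : Fin 3 → ℝ))

open Set Filter Topology

/-- The scalar triple product `(a × b) · c`. -/
def tripleProduct (a b c : Fin 3 → ℝ) : ℝ :=
  ∑ i : Fin 3, crossProduct a b i * c i

theorem tripleProduct_eq (a b c : Fin 3 → ℝ) :
    tripleProduct a b c = (a 1 * b 2 - a 2 * b 1) * c 0 + (a 2 * b 0 - a 0 * b 2) * c 1 +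
      (a 0 * b 1 - a 1 * b 0) * c 2 := by
  simp [tripleProduct, Fin.sum_univ_three, cross_apply]

theorem continuous_tripleProduct :
    Continuous fun q : (Fin 3 → ℝ) × (Fin 3 → ℝ) × (Fin 3 → ℝ) =>
      tripleProduct q.1 q.2.1 q.2.2 := by
  simp only [tripleProduct_eq]
  fun_prop

theorem ContinuousOn.tripleProduct {X : Type*} [TopologicalSpace X] {s : Set X}
    {a b c : X → Fin 3 → ℝ} (ha : ContinuousOn a s) (hb : ContinuousOn b s)
    (hc : ContinuousOn c s) : ContinuousOn (fun x => tripleProduct (a x) (b x) (c x)) s :=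
  continuous_tripleProduct.comp_continuousOn (f := fun x => (a x, b x, c x))
    (ha.prodMk (hb.prodMk hc))

/-- The triple product `(a × b) · c` as a continuous linear functional of `c`. -/
noncomputable def tripleProductCLM (a b : Fin 3 → ℝ) : (Fin 3 → ℝ) →L[ℝ] ℝ :=
  ∑ i : Fin 3, crossProduct a b i • ContinuousLinearMap.proj (R := ℝ) (φ := fun _ : Fin 3 => ℝ) i

theorem tripleProductCLM_apply (a b c : Fin 3 → ℝ) :
    tripleProductCLM a b c = tripleProduct a b c := by
  simp [tripleProductCLM, tripleProduct]

section Derivatives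

variable {V : Type*} [NormedAddCommGroup V] [NormedSpace ℝ V]

/-- The derivative of `q ↦ tripleProduct (G q u₀) (G q u₁) (G q u₂)` at a point where
`G` has value `A` and derivative `H`. -/
noncomputable def tripleProductFDeriv (A : V →L[ℝ] (Fin 3 → ℝ))
    (H : V →L[ℝ] V →L[ℝ] (Fin 3 → ℝ)) (u₀ u₁ u₂ : V) : V →L[ℝ] ℝ :=
  tripleProductCLM (A u₁) (A u₂) ∘L H.flip u₀ + tripleProductCLM (A u₂) (A u₀) ∘L H.flip u₁ +
    tripleProductCLM (A u₀) (A u₁) ∘L H.flip u₂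

theorem tripleProductFDeriv_apply (A : V →L[ℝ] (Fin 3 → ℝ))
    (H : V →L[ℝ] V →L[ℝ] (Fin 3 → ℝ)) (u₀ u₁ u₂ w : V) :
    tripleProductFDeriv A H u₀ u₁ u₂ w =
      tripleProduct (A u₁) (A u₂) (H w u₀) + tripleProduct (A u₂) (A u₀) (H w u₁) +
        tripleProduct (A u₀) (A u₁) (H w u₂) := by
  simp [tripleProductFDeriv, tripleProductCLM_apply]

theorem HasFDerivWithinAt.tripleProduct_apply {G : V → V →L[ℝ] (Fin 3 → ℝ)}
    {H : V →L[ℝ] V →L[ℝ] (Fin 3 → ℝ)} {s : Set V} {p : V} (hG : HasFDerivWithinAt G H s p)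
    (u₀ u₁ u₂ : V) :
    HasFDerivWithinAt (fun q => tripleProduct (G q u₀) (G q u₁) (G q u₂))
      (tripleProductFDeriv (G p) H u₀ u₁ u₂) s p := by
  have hc (u : V) (i : Fin 3) : HasFDerivWithinAt (fun q => G q u i)
      (ContinuousLinearMap.proj (R := ℝ) (φ := fun _ : Fin 3 => ℝ) i ∘L H.flip u) s p := by
    have h1 : HasFDerivWithinAt (fun q => G q u) (H.flip u) s p :=
      ((ContinuousLinearMap.apply ℝ (Fin 3 → ℝ) u).hasFDerivAt.comp_hasFDerivWithinAt p hG)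
    exact (ContinuousLinearMap.proj (R := ℝ) (φ := fun _ : Fin 3 => ℝ)
      i).hasFDerivAt.comp_hasFDerivWithinAt p h1
  simp only [tripleProduct_eq]
  refine (((((hc u₀ 1).mul (hc u₁ 2)).sub ((hc u₀ 2).mul (hc u₁ 1))).mul (hc u₂ 0)).add
    ((((hc u₀ 2).mul (hc u₁ 0)).sub ((hc u₀ 0).mul (hc u₁ 2))).mul (hc u₂ 1)) |>.add
    ((((hc u₀ 0).mul (hc u₁ 1)).sub ((hc u₀ 1).mul (hc u₁ 0))).mul (hc u₂ 2))).congr_fderiv ?_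
  ext w
  rw [tripleProductFDeriv_apply]
  simp [tripleProduct_eq]
  ring

/-- The Piola identity: the time derivative of the Jacobian determinant is the spatial
divergence of the velocity contracted with the cofactor matrix. -/
theorem tripleProductFDeriv_eq_divergence (A : V →L[ℝ] (Fin 3 → ℝ))
    (H : V →L[ℝ] V →L[ℝ] (Fin 3 → ℝ)) (hH : ∀ u w, H u w = H w u) (e₀ e₁ e₂ τ : V) :
    tripleProductFDeriv A H e₀ e₁ e₂ τ =
      tripleProductFDeriv A H e₁ e₂ τ e₀ + tripleProductFDeriv A H e₂ e₀ τ e₁ +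
        tripleProductFDeriv A H e₀ e₁ τ e₂ := by
  simp only [tripleProductFDeriv_apply, tripleProduct_eq]
  rw [hH e₁ e₀, hH e₂ e₀, hH e₂ e₁, hH e₀ τ, hH e₁ τ, hH e₂ τ]
  ring

theorem ContinuousOn.tripleProductFDeriv_apply {X : Type*} [TopologicalSpace X]
    {A : X → V →L[ℝ] (Fin 3 → ℝ)} {H : X → V →L[ℝ] V →L[ℝ] (Fin 3 → ℝ)} {s : Set X}
    (hA : ContinuousOn A s) (hH : ContinuousOn H s) (u₀ u₁ u₂ w : V) :
    ContinuousOn (fun x => tripleProductFDeriv (A x) (H x) u₀ u₁ u₂ w) s := by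
  have hA' (u : V) : ContinuousOn (fun x => A x u) s := hA.clm_apply continuousOn_const
  have hH' (u : V) : ContinuousOn (fun x => H x w u) s :=
    (hH.clm_apply continuousOn_const).clm_apply continuousOn_const
  simp only [_root_.tripleProductFDeriv_apply]
  exact (((hA' _).tripleProduct (hA' _) (hH' _)).add
    ((hA' _).tripleProduct (hA' _) (hH' _))).add ((hA' _).tripleProduct (hA' _) (hH' _))

end Derivatives

/-- Differentiation under the integral sign, for one-sided derivatives in a convex set. -/
theorem hasDerivWithinAt_integral_of_bound {X : Type*} [MeasurableSpace X] {μ : Measure X}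
    [IsFiniteMeasure μ] {I : Set ℝ} (hI : Convex ℝ I) {g h : ℝ → X → ℝ} {C : ℝ}
    (hint : ∀ s ∈ I, Integrable (g s) μ)
    (hderiv : ∀ᵐ x ∂μ, ∀ s ∈ I, HasDerivWithinAt (fun r => g r x) (h s x) I s)
    (hbound : ∀ᵐ x ∂μ, ∀ s ∈ I, ‖h s x‖ ≤ C) {t : ℝ} (ht : t ∈ I) :
    HasDerivWithinAt (fun s => ∫ x, g s x ∂μ) (∫ x, h t x ∂μ) I t := by
  rw [hasDerivWithinAt_iff_tendsto_slope]
  have hlim : Tendsto (fun s => ∫ x, slope (fun r => g r x) t s ∂μ) (𝓝[I \ {t}] t)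
      (𝓝 (∫ x, h t x ∂μ)) := by
    refine tendsto_integral_filter_of_dominated_convergence (fun _ => C) ?_ ?_
      (integrable_const C) ?_
    · filter_upwards [self_mem_nhdsWithin] with s hs
      simp only [slope_def_field]
      exact (((hint s hs.1).sub (hint t ht)).div_const _).aestronglyMeasurable
    · filter_upwards [self_mem_nhdsWithin] with s hs
      filter_upwards [hderiv, hbound] with x hx hb
      have hst : 0 < ‖s - t‖ := norm_pos_iff.2 (sub_ne_zero.2 hs.2)
      rw [slope_def_field, norm_div, div_le_iff₀ hst]
      exact hI.norm_image_sub_le_of_norm_hasDerivWithin_le hx hb ht hs.1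
    · filter_upwards [hderiv] with x hx
      exact hasDerivWithinAt_iff_tendsto_slope.1 (hx t ht)
  refine hlim.congr' ?_
  filter_upwards [self_mem_nhdsWithin] with s hs
  simp only [slope_def_field]
  rw [integral_div, integral_sub (hint s hs.1) (hint t ht)]

section Slab

variable {T : ℝ}

theorem mk_mem_timeSlab {t : ℝ} (ht : t ∈ Icc 0 T) (x : Fin 3 → ℝ) : (t, x) ∈ timeSlab T :=
  ⟨ht, mem_univ x⟩

theorem uniqueDiffOn_timeSlab (hT : 0 < T) : UniqueDiffOn ℝ (timeSlab T) :=
  (uniqueDiffOn_Icc hT).prod uniqueDiffOn_univ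

theorem closure_interior_timeSlab (hT : 0 < T) : closure (interior (timeSlab T)) = timeSlab T := by
  rw [timeSlab, interior_prod_eq, closure_prod_eq, closure_interior_Icc hT.ne, interior_univ,
    closure_univ]

theorem HasFDerivWithinAt.hasFDerivAt_space {f : ℝ × (Fin 3 → ℝ) → ℝ}
    {L : ℝ × (Fin 3 → ℝ) →L[ℝ] ℝ} {t : ℝ} (ht : t ∈ Icc 0 T) {x : Fin 3 → ℝ}
    (hf : HasFDerivWithinAt f L (timeSlab T) (t, x)) :
    HasFDerivAt (fun y => f (t, y)) (L ∘L ContinuousLinearMap.inr ℝ ℝ (Fin 3 → ℝ)) x := by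
  rw [← hasFDerivWithinAt_univ]
  exact hf.comp x (hasFDerivAt_prodMk_right t x).hasFDerivWithinAt
    fun y _ => mk_mem_timeSlab ht y

theorem HasFDerivWithinAt.hasDerivWithinAt_time {f : ℝ × (Fin 3 → ℝ) → ℝ}
    {L : ℝ × (Fin 3 → ℝ) →L[ℝ] ℝ} {t : ℝ} {x : Fin 3 → ℝ}
    (hf : HasFDerivWithinAt f L (timeSlab T) (t, x)) :
    HasDerivWithinAt (fun s => f (s, x)) (L (1, 0)) (Icc 0 T) t := by
  have h := hf.comp t (hasFDerivAt_prodMk_left t x).hasFDerivWithinAt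
    fun s (hs : s ∈ Icc 0 T) => mk_mem_timeSlab hs x
  simpa [Function.comp_def] using h.hasDerivWithinAt

open scoped Pointwise in
theorem fderivWithin_timeSlab_add {η : ℝ × (Fin 3 → ℝ) → (Fin 3 → ℝ)} {k : Fin 3 → ℝ}
    (hk : ∀ t ∈ Icc (0 : ℝ) T, ∀ x : Fin 3 → ℝ, η (t, x + k) = η (t, x) + k)
    {t : ℝ} (ht : t ∈ Icc 0 T) (x : Fin 3 → ℝ) :
    fderivWithin ℝ η (timeSlab T) (t, x + k) = fderivWithin ℝ η (timeSlab T) (t, x) := by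
  have hs : ((0 : ℝ), k) +ᵥ timeSlab T = timeSlab T := by
    ext ⟨s, y⟩
    simp [Set.mem_vadd_set_iff_neg_vadd_mem, timeSlab]
  have h1 := fderivWithin_comp_add_right (𝕜 := ℝ) (f := η) (s := timeSlab T) (x := (t, x)) (0, k)
  rw [hs] at h1
  rw [show (t, x + k) = (t, x) + ((0 : ℝ), k) by simp, ← h1,
    ← fderivWithin_add_const (f := η) k]
  refine fderivWithin_congr' ?_ (mk_mem_timeSlab ht x)
  rintro ⟨s, y⟩ hy
  simpa using hk s hy.1 y

/-- Derivatives of the vertical component along the bottom vanish in tangential directions. -/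
theorem fderivWithin_timeSlab_bottom (hT : 0 < T) {η : ℝ × (Fin 3 → ℝ) → (Fin 3 → ℝ)}
    (hη : DifferentiableOn ℝ η (timeSlab T))
    (hbot : ∀ t ∈ Icc (0 : ℝ) T, ∀ x : Fin 3 → ℝ, x 2 = 0 → η (t, x) 2 = 0)
    {t : ℝ} (ht : t ∈ Icc 0 T) {x : Fin 3 → ℝ} (hx : x 2 = 0)
    {w : ℝ × (Fin 3 → ℝ)} (hw : w.2 2 = 0) :
    fderivWithin ℝ η (timeSlab T) (t, x) w 2 = 0 := by
  let Q : (Fin 3 → ℝ) →L[ℝ] (Fin 3 → ℝ) := ContinuousLinearMap.pi fun i =>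
    if i = 2 then 0 else ContinuousLinearMap.proj i
  have hQ2 (y : Fin 3 → ℝ) : Q y 2 = 0 := by simp [Q]
  have hQ (y : Fin 3 → ℝ) (hy : y 2 = 0) : Q y = y := by
    ext i
    by_cases hi : i = 2
    · rw [hi, hQ2, hy]
    · simp [Q, hi]
  let P : ℝ × (Fin 3 → ℝ) →L[ℝ] ℝ × (Fin 3 → ℝ) := (ContinuousLinearMap.id ℝ ℝ).prodMap Q
  have hP (y : ℝ × (Fin 3 → ℝ)) (hy : y.2 2 = 0) : P y = y := Prod.ext rfl (hQ y.2 hy)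
  have hmaps : MapsTo P (timeSlab T) (timeSlab T) := fun q hq => ⟨hq.1, mem_univ _⟩
  have hp := mk_mem_timeSlab ht x
  have h1 : HasFDerivWithinAt η (fderivWithin ℝ η (timeSlab T) (t, x)) (timeSlab T) (P (t, x)) := by
    rw [hP (t, x) hx]
    exact (hη _ hp).hasFDerivWithinAt
  have h2 := (ContinuousLinearMap.proj (R := ℝ) (φ := fun _ : Fin 3 => ℝ)
    2).hasFDerivAt.comp_hasFDerivWithinAt (t, x) (h1.comp (t, x) P.hasFDerivWithinAt hmaps)
  have h3 : HasFDerivWithinAt (fun _ : ℝ × (Fin 3 → ℝ) => (0 : ℝ)) _ (timeSlab T) (t, x) :=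
    h2.congr (fun q hq => (hbot q.1 hq.1 _ (hQ2 q.2)).symm)
      (hbot t ht _ (hQ2 x)).symm
  have h4 := (uniqueDiffOn_timeSlab hT _ hp).eq h3 (hasFDerivWithinAt_const 0 _ _)
  have h5 := DFunLike.congr_fun h4 w
  simpa [hP w hw] using h5

theorem det_DxW (η : ℝ × (Fin 3 → ℝ) → (Fin 3 → ℝ)) (p : ℝ × (Fin 3 → ℝ)) :
    (DxW T η p).det = tripleProduct (fderivWithin ℝ η (timeSlab T) p (0, Pi.single 0 1))
      (fderivWithin ℝ η (timeSlab T) p (0, Pi.single 1 1))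
      (fderivWithin ℝ η (timeSlab T) p (0, Pi.single 2 1)) := by
  rw [Matrix.det_fin_three, tripleProduct_eq]
  simp only [DxW, Matrix.of_apply]
  ring

end Slab

/-- **Rate of change of the Lagrangian volume equals the flux through the free
boundary.** Let `η : [0,T] × ℝ³ → ℝ³` be `C²`, horizontally `ℤ²`-periodic
(`η(t,x+k) = η(t,x)+k` for `k ∈ ℤ² × {0}`), with `η³(t,x) = 0` whenever `x₃ = 0`.
Then for every `t ∈ [0,T]`,
`d/dt ∫_{[0,1]³} det D_xη dx = ∫_{[0,1]²} (∂₁η × ∂₂η) · v (t,(x₁,x₂,1)) dx₁dx₂`. -/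
theorem volume_derivative_eq_boundary_flux (T : ℝ) (hT : 0 < T)
    (η : ℝ × (Fin 3 → ℝ) → (Fin 3 → ℝ))
    (hη : ContDiffOn ℝ 2 η (timeSlab T))
    (hper : ∀ (m n : ℤ), ∀ t ∈ Set.Icc (0 : ℝ) T, ∀ x : Fin 3 → ℝ,
      η (t, x + ![(m : ℝ), (n : ℝ), 0]) = η (t, x) + ![(m : ℝ), (n : ℝ), 0])
    (hbot : ∀ t ∈ Set.Icc (0 : ℝ) T, ∀ x : Fin 3 → ℝ, x 2 = 0 → η (t, x) 2 = 0) :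
    ∀ t ∈ Set.Icc (0 : ℝ) T,
      HasDerivWithinAt
        (fun s => ∫ x in Set.Icc (0 : Fin 3 → ℝ) 1, (DxW T η (s, x)).det)
        (∫ y in Set.Icc (0 : Fin 2 → ℝ) 1,
          ∑ i : Fin 3,
            crossProduct (fun r => DxW T η (t, ![y 0, y 1, 1]) r 0)
                (fun r => DxW T η (t, ![y 0, y 1, 1]) r 1) i *
              vW T η (t, ![y 0, y 1, 1]) i)
        (Set.Icc 0 T) t := by
  intro t ht
  have hU := uniqueDiffOn_timeSlab hT
  have hdiff : DifferentiableOn ℝ η (timeSlab T) := hη.differentiableOn (by norm_num)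
  set G := fderivWithin ℝ η (timeSlab T) with hGdef
  have hG1 : ContDiffOn ℝ 1 G (timeSlab T) := hη.fderivWithin hU (by norm_num)
  set H := fderivWithin ℝ G (timeSlab T) with hHdef
  have hGc : ContinuousOn G (timeSlab T) := hG1.continuousOn
  have hHc : ContinuousOn H (timeSlab T) := hG1.continuousOn_fderivWithin hU le_rfl
  have hGH : ∀ p ∈ timeSlab T, HasFDerivWithinAt G (H p) (timeSlab T) p := fun p hp =>
    (hG1.differentiableOn (by norm_num) p hp).hasFDerivWithinAt
  have hsymm : ∀ p ∈ timeSlab T, ∀ u w, H p u w = H p w u := fun p hp =>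
    (hη p hp).isSymmSndFDerivWithinAt (by simp) hU
      (by rwa [closure_interior_timeSlab hT]) hp
  let e : Fin 3 → ℝ × (Fin 3 → ℝ) := fun j => (0, Pi.single j 1)
  let τ : ℝ × (Fin 3 → ℝ) := (1, 0)
  let h : ℝ → (Fin 3 → ℝ) → ℝ := fun s x =>
    tripleProductFDeriv (G (s, x)) (H (s, x)) (e 0) (e 1) (e 2) τ
  have hhc : ContinuousOn (fun p : ℝ × (Fin 3 → ℝ) => h p.1 p.2) (timeSlab T) :=
    hGc.tripleProductFDeriv_apply hHc _ _ _ _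
  have hslice {s : ℝ} (hs : s ∈ Icc 0 T) {f : ℝ × (Fin 3 → ℝ) → ℝ}
      (hf : ContinuousOn f (timeSlab T)) (K : Set (Fin 3 → ℝ)) :
      ContinuousOn (fun x => f (s, x)) K :=
    hf.comp (by fun_prop) fun x _ => mk_mem_timeSlab hs x
  have hGu (u : ℝ × (Fin 3 → ℝ)) : ContinuousOn (fun p => G p u) (timeSlab T) :=
    hGc.clm_apply continuousOn_const
  obtain ⟨C, hC⟩ := (isCompact_Icc.prod
    (isCompact_Icc (a := (0 : Fin 3 → ℝ)) (b := 1))).exists_bound_of_continuousOn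
    (hhc.mono (prod_mono (subset_refl (Icc 0 T)) (subset_univ _)))
  have : IsFiniteMeasure (volume.restrict (Icc (0 : Fin 3 → ℝ) 1)) :=
    isFiniteMeasure_restrict.2 isCompact_Icc.measure_lt_top.ne
  have hder := hasDerivWithinAt_integral_of_bound (μ := volume.restrict (Icc (0 : Fin 3 → ℝ) 1))
    (convex_Icc 0 T) (g := fun s x => (DxW T η (s, x)).det) (h := h) (C := C)
    (fun s hs => by
      simp only [det_DxW]
      exact (hslice hs ((hGu _).tripleProduct (hGu _) (hGu _)) _).integrableOn_compact
        isCompact_Icc)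
    (ae_of_all _ fun x s hs => by
      simp only [det_DxW]
      exact ((hGH _ (mk_mem_timeSlab hs x)).tripleProduct_apply _ _ _).hasDerivWithinAt_time)
    (by
      filter_upwards [ae_restrict_mem measurableSet_Icc] with x hx s hs
      exact hC (s, x) ⟨hs, hx⟩) ht
  convert hder using 1
  let a : Fin 3 → ℝ × (Fin 3 → ℝ) := ![e 1, e 2, e 0]
  let b : Fin 3 → ℝ × (Fin 3 → ℝ) := ![e 2, e 0, e 1]
  let f : Fin 3 → (Fin 3 → ℝ) → ℝ := fun i x =>
    tripleProduct (G (t, x) (a i)) (G (t, x) (b i)) (G (t, x) τ)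
  let f' : Fin 3 → (Fin 3 → ℝ) → (Fin 3 → ℝ) →L[ℝ] ℝ := fun i x =>
    tripleProductFDeriv (G (t, x)) (H (t, x)) (a i) (b i) τ ∘L
      ContinuousLinearMap.inr ℝ ℝ (Fin 3 → ℝ)
  have hdiv (x : Fin 3 → ℝ) : ∑ i, f' i x (Pi.single i 1) = h t x := by
    simp only [h, Fin.sum_univ_three]
    rw [tripleProductFDeriv_eq_divergence _ _ (hsymm _ (mk_mem_timeSlab ht x))]
    rfl
  have hdivthm := integral_divergence_of_hasFDerivAt_off_countable' (0 : Fin 3 → ℝ) 1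
    zero_le_one f f' ∅ countable_empty
    (fun i => hslice ht ((hGu _).tripleProduct (hGu _) (hGu _)) _)
    (fun x _ i => ((hGH _ (mk_mem_timeSlab ht x)).tripleProduct_apply _ _ _).hasFDerivAt_space ht)
    (by
      simp only [hdiv]
      exact (hslice ht hhc _).integrableOn_compact isCompact_Icc)
  simp only [hdiv] at hdivthm
  rw [hdivthm, Fin.sum_univ_three]
  have hside (i : Fin 3) (m n : ℤ) (hi : (Pi.single i 1 : Fin 3 → ℝ) = ![(m : ℝ), (n : ℝ), 0])
      (y : Fin 2 → ℝ) : f i (i.insertNth 1 y) = f i (i.insertNth 0 y) := by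
    have hy : (i.insertNth 1 y : Fin 3 → ℝ) =
        (i.insertNth 0 y : Fin 3 → ℝ) + ![(m : ℝ), (n : ℝ), 0] := by
      rw [← hi]
      ext j
      refine i.succAboveCases ?_ (fun k => ?_) j
      · simp
      · simp
    simp only [f]
    rw [hy, hGdef, fderivWithin_timeSlab_add (hper m n) ht]
  have hbottom (y : Fin 2 → ℝ) : f 2 ((2 : Fin 3).insertNth 0 y) = 0 := by
    have hx : ((2 : Fin 3).insertNth 0 y : Fin 3 → ℝ) 2 = 0 := Fin.insertNth_apply_same _ _ _
    have hz (w : ℝ × (Fin 3 → ℝ)) (hw : w.2 2 = 0) :=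
      fderivWithin_timeSlab_bottom hT hdiff hbot ht hx hw
    have h0 := hz (e 0) (by simp [e])
    have h1 := hz (e 1) (by simp [e])
    have h2 := hz τ (by simp [τ])
    simp only [f, a, b, tripleProduct_eq, hGdef]
    simp [h0, h1, h2]
  have htop (y : Fin 2 → ℝ) : ((2 : Fin 3).insertNth 1 y : Fin 3 → ℝ) = ![y 0, y 1, 1] := by
    ext j
    fin_cases j <;> rfl
  simp only [Pi.one_apply, Pi.zero_apply, hside 0 1 0 (by ext j; fin_cases j <;> simp),
    hside 1 0 1 (by ext j; fin_cases j <;> simp), hbottom, sub_self, integral_zero, htop,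
    zero_add, sub_zero]
  rfl
end
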